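/- Let $D$ be a finite index set, $\mathcal{F}$ and $\mathcal{G}$ finite index sets, and for each $F \in \mathcal{F}$ let $D_F \subseteq D$ and for each $G \in \mathcal{G}$ let $D_G \subseteq D$, with restriction matrices $R_F$, $R_G$, $R_{G \mapsto F}$ (the last defined whenever $D_F \subseteq D_G$, restricting $D_G$-vectors to $D_F$-vectors). Let $P \subseteq \mathcal{F} \times \mathcal{G}$ be a relation such that $(F,G) \in P$ implies $D_F \subseteq D_G$, let $A_F$ be a real square matrix indexed by $D_F$ for each $F$, and let scaling factors $\sigma_{F,G} \in \mathbb{R}$ for $(F,G) \in P$ satisfy the partition-of-unity condition $\sum_{G : (F,G) \in P} \sigma_{F,G} = 1$ for every $F \in \mathcal{F}$. Define the macrostructure matrices $A_G := \sum_{F : (F,G) \in P} \sigma_{F,G}\, R_{G \mapsto F}^T A_F R_{G \mapsto F}$. Then $\sum_{G \in \mathcal{G}} R_G^T A_G R_G = \sum_{F \in \mathcal{F}} R_F^T A_F R_F$; in particular, if $A = \sum_{F \in \mathcal{F}} R_F^T A_F R_F$, then also $A = \sum_{G \in \mathcal{G}} R_G^T A_G R_G$. -/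

import Mathlib

open Matrix

/-- If the macrostructure matrices `A_G` are assembled from the structure matrices `A_F` with
scaling factors forming a partition of unity, then the global assembly from the macrostructure
matrices agrees with the global assembly from the structure matrices. -/
theorem macrostructure_assembly
    {D : Type*} [Fintype D] [DecidableEq D]
    {F G : Type*} [Fintype F] [Fintype G]
    (DF : F → Finset D) (DG : G → Finset D)
    (P : F → G → Prop) [∀ f g, Decidable (P f g)]
    (hP : ∀ f g, P f g → DF f ⊆ DG g)
    (AF : ∀ f, Matrix (DF f) (DF f) ℝ)
    (σ : F → G → ℝ)
    (hσ : ∀ f, ∑ g ∈ Finset.univ.filter (fun g => P f g), σ f g = 1)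
    (RF : ∀ f, Matrix (DF f) D ℝ)
    (hRF : ∀ f k l, RF f k l = if (k : D) = l then 1 else 0)
    (RG : ∀ g, Matrix (DG g) D ℝ)
    (hRG : ∀ g k l, RG g k l = if (k : D) = l then 1 else 0)
    (RGF : ∀ f g, Matrix (DF f) (DG g) ℝ)
    (hRGF : ∀ f g k l, RGF f g k l = if (k : D) = (l : D) then 1 else 0)
    (AG : ∀ g, Matrix (DG g) (DG g) ℝ)
    (hAG : ∀ g, AG g = ∑ f ∈ Finset.univ.filter (fun f => P f g),
      σ f g • ((RGF f g)ᵀ * AF f * RGF f g)) :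
    ∑ g, (RG g)ᵀ * AG g * RG g = ∑ f, (RF f)ᵀ * AF f * RF f := by
  have hR : ∀ f g, P f g → RGF f g * RG g = RF f := by
    intro f g h
    ext k l
    rw [Matrix.mul_apply, Finset.sum_eq_single ⟨k, hP f g h k.2⟩]
    · simp [hRGF, hRG, hRF]
    · intro m _ hm
      have hkm : (k : D) ≠ m := fun e => hm (Subtype.ext e.symm)
      simp [hRGF, hkm]
    · simp
  have hterm : ∀ f g, P f g →
      (RG g)ᵀ * ((RGF f g)ᵀ * AF f * RGF f g) * RG g = (RF f)ᵀ * AF f * RF f := by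
    intro f g h
    rw [← hR f g h, Matrix.transpose_mul]
    simp only [Matrix.mul_assoc]
  calc ∑ g, (RG g)ᵀ * AG g * RG g
      = ∑ g, ∑ f, if P f g then σ f g • ((RF f)ᵀ * AF f * RF f) else 0 := by
        refine Finset.sum_congr rfl fun g _ => ?_
        rw [hAG, Matrix.mul_sum, Matrix.sum_mul, ← Finset.sum_filter]
        refine Finset.sum_congr rfl fun f hf => ?_
        rw [Matrix.mul_smul, Matrix.smul_mul, hterm f g (Finset.mem_filter.mp hf).2]
    _ = ∑ f, (RF f)ᵀ * AF f * RF f := by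
        rw [Finset.sum_comm]
        refine Finset.sum_congr rfl fun f _ => ?_
        rw [← Finset.sum_filter, ← Finset.sum_smul, hσ, one_smul]
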